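/- Let k ≥ 1 be an integer and let p be a prime such that S_k(x) is irreducible in 𝔽_p[x]. Then p is a k-Shanks prime if and only if the image of the polynomial S_k(x^p) is zero in the ring (ℤ/p²ℤ)[x]/(S_k(x)). -/

import Mathlib

open Polynomial

/-- The sequence `U₀ = U₁ = 0`, `U₂ = 1`,
`U_n = k·U_{n−1} + (k+3)·U_{n−2} + U_{n−3}` for `n ≥ 3`. -/
def shanksSeq (k : ℤ) : ℕ → ℤ
  | 0 => 0
  | 1 => 0
  | 2 => 1
  | n + 3 => k * shanksSeq k (n + 2) + (k + 3) * shanksSeq k (n + 1) + shanksSeq k n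

/-- `π(m)`: the least period of the sequence `(U_n)` modulo `m`. -/
noncomputable def shanksPeriod (k : ℤ) (m : ℕ) : ℕ :=
  sInf {n : ℕ | 0 < n ∧ ∀ j : ℕ, (shanksSeq k (j + n) : ZMod m) = (shanksSeq k j : ZMod m)}

/-- A prime `p` is a `k`-Shanks prime if `π(p²) = π(p)`. -/
def IsShanksPrime (k : ℤ) (p : ℕ) : Prop :=
  p.Prime ∧ shanksPeriod k (p ^ 2) = shanksPeriod k p

/-- The Shanks polynomial `x³ − k·x² − (k+3)·x − 1` over a commutative ring. -/
noncomputable def shanksPoly {A : Type*} [CommRing A] (k : A) : A[X] :=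
  X ^ 3 - C k * X ^ 2 - C (k + 3) * X - 1

section Poly

variable {A B : Type*} [CommRing A] [CommRing B]

lemma shanksPoly_natDegree [Nontrivial A] (k : A) : (shanksPoly k).natDegree = 3 := by
  unfold shanksPoly; compute_degree!

lemma shanksPoly_monic (k : A) : (shanksPoly k).Monic := by
  unfold shanksPoly; monicity!

lemma shanksPoly_map (f : A →+* B) (k : A) : (shanksPoly k).map f = shanksPoly (f k) := by
  simp [shanksPoly, C_add, map_ofNat f]

lemma shanksPoly_aeval [Algebra A B] (k : A) (x : B) :
    aeval x (shanksPoly k) =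
      x ^ 3 - algebraMap A B k * x ^ 2 - (algebraMap A B k + 3) * x - 1 := by
  simp [shanksPoly, map_ofNat (algebraMap A B)]

lemma shanksPoly_root_eq (k : A) :
    (AdjoinRoot.root (shanksPoly k)) ^ 3 = algebraMap A _ k * (AdjoinRoot.root (shanksPoly k)) ^ 2
      + (algebraMap A _ k + 3) * AdjoinRoot.root (shanksPoly k) + 1 := by
  have h : aeval (AdjoinRoot.root (shanksPoly k)) (shanksPoly k) = 0 := by simp
  rw [shanksPoly_aeval] at h
  linear_combination h

lemma shanksPoly_isUnit_root (k : A) : IsUnit (AdjoinRoot.root (shanksPoly k)) := by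
  refine IsUnit.of_mul_eq_one ((AdjoinRoot.root (shanksPoly k)) ^ 2 -
    algebraMap A _ k * AdjoinRoot.root (shanksPoly k) - (algebraMap A _ k + 3)) ?_
  linear_combination shanksPoly_root_eq k

lemma shanksPoly_root_linearIndependent (k a b c : A)
    (h : algebraMap A (AdjoinRoot (shanksPoly k)) a * AdjoinRoot.root (shanksPoly k) ^ 2
      + algebraMap A _ b * AdjoinRoot.root (shanksPoly k) + algebraMap A _ c = 0) :
    a = 0 ∧ b = 0 ∧ c = 0 := by
  nontriviality A
  have h2 : AdjoinRoot.mk (shanksPoly k) (C a * X ^ 2 + C b * X + C c) = 0 := by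
    simpa [AdjoinRoot.algebraMap_eq] using h
  rw [AdjoinRoot.mk_eq_zero] at h2
  have h0 : C a * X ^ 2 + C b * X + C c = 0 := by
    by_contra hne
    refine (shanksPoly_monic k).not_dvd_of_natDegree_lt hne ?_ h2
    rw [shanksPoly_natDegree]
    exact lt_of_le_of_lt natDegree_quadratic_le (by norm_num)
  refine ⟨?_, ?_, ?_⟩
  · simpa [coeff_X, coeff_C] using congrArg (coeff · 2) h0
  · simpa [coeff_X, coeff_C] using congrArg (coeff · 1) h0
  · simpa [coeff_X, coeff_C] using congrArg (coeff · 0) h0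

end Poly

lemma shanksSeq_add_three (k : ℤ) (n : ℕ) :
    shanksSeq k (n + 3) =
      k * shanksSeq k (n + 2) + (k + 3) * shanksSeq k (n + 1) + shanksSeq k n := by
  rw [shanksSeq]

lemma shanksPoly_root_pow (k : ℤ) (m n : ℕ) :
    AdjoinRoot.root (shanksPoly (k : ZMod m)) ^ n =
      (shanksSeq k n : AdjoinRoot (shanksPoly (k : ZMod m)))
          * AdjoinRoot.root (shanksPoly (k : ZMod m)) ^ 2
        + ((shanksSeq k (n + 1) - k * shanksSeq k n : ℤ) : AdjoinRoot (shanksPoly (k : ZMod m)))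
          * AdjoinRoot.root (shanksPoly (k : ZMod m))
        + ((shanksSeq k (n + 2) - k * shanksSeq k (n + 1) - (k + 3) * shanksSeq k n : ℤ) :
            AdjoinRoot (shanksPoly (k : ZMod m))) := by
  induction n with
  | zero => simp [shanksSeq]
  | succ n ih =>
    have h := shanksPoly_root_eq (k : ZMod m)
    rw [map_intCast] at h
    rw [pow_succ, ih, shanksSeq_add_three]
    push_cast
    linear_combination (shanksSeq k n : AdjoinRoot (shanksPoly (k : ZMod m))) * h

lemma shanksSeq_periodic_iff (k : ℤ) (m n : ℕ) :
    (∀ j : ℕ, (shanksSeq k (j + n) : ZMod m) = (shanksSeq k j : ZMod m)) ↔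
      AdjoinRoot.root (shanksPoly (k : ZMod m)) ^ n = 1 := by
  have cast (z : ℤ) : (z : AdjoinRoot (shanksPoly (k : ZMod m))) =
      algebraMap (ZMod m) _ (z : ZMod m) := (map_intCast _ z).symm
  constructor
  · intro h
    have h0 : (shanksSeq k n : ZMod m) = 0 := by simpa [shanksSeq] using h 0
    have h1 : (shanksSeq k (n + 1) : ZMod m) = 0 := by simpa [shanksSeq, add_comm] using h 1
    have h2 : (shanksSeq k (n + 2) : ZMod m) = 1 := by simpa [shanksSeq, add_comm] using h 2
    rw [shanksPoly_root_pow, cast, cast, cast]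
    simp [h0, h1, h2]
  · intro h
    rw [shanksPoly_root_pow, cast, cast, cast, ← sub_eq_zero, add_sub_assoc,
      ← map_one (algebraMap (ZMod m) (AdjoinRoot (shanksPoly (k : ZMod m)))),
      ← map_sub (algebraMap (ZMod m) _)] at h
    obtain ⟨h0, h1, h2⟩ := shanksPoly_root_linearIndependent _ _ _ _ h
    push_cast at h1 h2
    rw [h0] at h1 h2
    have h1' : (shanksSeq k (n + 1) : ZMod m) = 0 := by linear_combination h1
    rw [h1'] at h2
    have h2' : (shanksSeq k (n + 2) : ZMod m) = 1 := by linear_combination h2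
    have key (j : ℕ) : (shanksSeq k (j + n) : ZMod m) = shanksSeq k j ∧
        (shanksSeq k (j + 1 + n) : ZMod m) = shanksSeq k (j + 1) ∧
        (shanksSeq k (j + 2 + n) : ZMod m) = shanksSeq k (j + 2) := by
      induction j with
      | zero => simp [shanksSeq, h0, h1', h2', add_comm _ n]
      | succ j ih =>
        obtain ⟨i0, i1, i2⟩ := ih
        refine ⟨i1, i2, ?_⟩
        rw [show j + 1 + 2 + n = j + n + 3 by ring, show j + 1 + 2 = j + 3 by ring,
          shanksSeq_add_three, shanksSeq_add_three, show j + n + 2 = j + 2 + n by ring,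
          show j + n + 1 = j + 1 + n by ring]
        push_cast
        rw [i0, i1, i2]
    exact fun j => (key j).1

lemma sInf_pow_eq_one_eq_orderOf {M : Type*} [Monoid M] (x : M) :
    sInf {n : ℕ | 0 < n ∧ x ^ n = 1} = orderOf x := by
  by_cases hx : IsOfFinOrder x
  · have hmem : orderOf x ∈ {n : ℕ | 0 < n ∧ x ^ n = 1} := ⟨hx.orderOf_pos, pow_orderOf_eq_one x⟩
    have := Nat.sInf_mem ⟨_, hmem⟩
    exact le_antisymm (Nat.sInf_le hmem) (orderOf_le_of_pow_eq_one this.1 this.2)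
  · rw [orderOf_eq_zero hx, Nat.sInf_eq_zero]
    right
    rw [Set.eq_empty_iff_forall_notMem]
    rintro n ⟨hn, h⟩
    exact hx (isOfFinOrder_iff_pow_eq_one.2 ⟨n, hn, h⟩)

lemma shanksPeriod_eq_orderOf (k : ℤ) (m : ℕ) :
    shanksPeriod k m = orderOf (AdjoinRoot.root (shanksPoly (k : ZMod m))) := by
  simp only [shanksPeriod, shanksSeq_periodic_iff, sInf_pow_eq_one_eq_orderOf]

/-- Modulo `p²`, a unipotent-mod-`p` element of order prime to `p` is trivial. -/
lemma eq_one_of_dvd_sub_one {A : Type*} [CommRing A] {p N : ℕ} (hA : (p : A) ^ 2 = 0)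
    (hN : N.Coprime p) {u : A} (hu : (p : A) ∣ u - 1) (huN : u ^ N = 1) : u = 1 := by
  have h := dvd_sub_pow_of_dvd_sub (R := A) (p := p) hu 1
  simp only [pow_one, one_pow, one_add_one_eq_two, hA, zero_dvd_iff] at h
  have h1 : orderOf u ∣ 1 := by
    rw [← hN]
    exact Nat.dvd_gcd (orderOf_dvd_of_pow_eq_one huN)
      (orderOf_dvd_of_pow_eq_one (sub_eq_zero.1 h))
  exact orderOf_eq_one_iff.1 (Nat.dvd_one.1 h1)

lemma eq_of_dvd_sub_of_pow_eq_one {A : Type*} [CommRing A] {p N : ℕ} (hA : (p : A) ^ 2 = 0)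
    (hN : N.Coprime p) {a b : A} (hab : (p : A) ∣ a - b) (ha : a ^ N = 1) (hb : b ^ N = 1)
    (hunit : IsUnit b) : a = b := by
  obtain ⟨c, hc⟩ := hunit.exists_right_inv
  have h : a * c = 1 := by
    refine eq_one_of_dvd_sub_one hA hN ?_ ?_
    · rw [← hc, ← sub_mul]
      exact hab.mul_right c
    · have := congrArg (· ^ N) hc
      simp only [mul_pow, hb, one_mul, one_pow] at this
      rw [mul_pow, ha, this, one_mul]
  linear_combination b * h - a * hc

lemma C_natCast_dvd_of_map_castHom_eq_zero {m n : ℕ} (h : m ∣ n) {g : (ZMod n)[X]}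
    (hg : g.map (ZMod.castHom h (ZMod m)) = 0) : C (m : ZMod n) ∣ g := by
  rw [C_dvd_iff_dvd_coeff]
  intro i
  have hi : ZMod.castHom h (ZMod m) (g.coeff i) = 0 := by
    rw [← coeff_map, hg, coeff_zero]
  obtain ⟨z, hz⟩ := ZMod.intCast_surjective (g.coeff i)
  rw [← hz, map_intCast, ZMod.intCast_zmod_eq_zero_iff_dvd] at hi
  obtain ⟨w, rfl⟩ := hi
  exact ⟨w, by rw [← hz]; push_cast; rfl⟩

/-- Reduction of `(ℤ/n)[x]/(S_k)` modulo a divisor `m` of `n`. -/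
noncomputable def shanksReduction (k : ℤ) {m n : ℕ} (h : m ∣ n) :
    AdjoinRoot (shanksPoly (k : ZMod n)) →+* AdjoinRoot (shanksPoly (k : ZMod m)) :=
  AdjoinRoot.lift ((AdjoinRoot.of _).comp (ZMod.castHom h (ZMod m))) (AdjoinRoot.root _) (by
    rw [← eval₂_map, shanksPoly_map, map_intCast, AdjoinRoot.eval₂_root])

section Reduction

variable (k : ℤ) {m n : ℕ} (h : m ∣ n)

lemma shanksReduction_root :
    shanksReduction k h (AdjoinRoot.root _) = AdjoinRoot.root _ := by
  simp [shanksReduction]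

lemma shanksReduction_mk (g : (ZMod n)[X]) :
    shanksReduction k h (AdjoinRoot.mk _ g) =
      AdjoinRoot.mk _ (g.map (ZMod.castHom h (ZMod m))) := by
  rw [shanksReduction, AdjoinRoot.lift_mk, ← eval₂_map, ← AdjoinRoot.aeval_eq]
  rfl

lemma natCast_dvd_of_shanksReduction_eq_zero {x : AdjoinRoot (shanksPoly (k : ZMod n))}
    (hx : shanksReduction k h x = 0) : (m : AdjoinRoot (shanksPoly (k : ZMod n))) ∣ x := by
  obtain ⟨g, rfl⟩ := AdjoinRoot.mk_surjective x
  have hg : AdjoinRoot.mk (shanksPoly (k : ZMod m)) (g.map (ZMod.castHom h (ZMod m))) = 0 := by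
    rw [← shanksReduction_mk, hx]
  rw [AdjoinRoot.mk_eq_zero] at hg
  obtain ⟨q, hq⟩ := hg
  obtain ⟨q', rfl⟩ := map_surjective _ (ZMod.castHom_surjective h) q
  have h0 : (g - shanksPoly (k : ZMod n) * q').map (ZMod.castHom h (ZMod m)) = 0 := by
    rw [Polynomial.map_sub, Polynomial.map_mul, shanksPoly_map, map_intCast, hq, sub_self]
  obtain ⟨t, ht⟩ := C_natCast_dvd_of_map_castHom_eq_zero h h0
  refine ⟨AdjoinRoot.mk _ t, ?_⟩
  have := congrArg (AdjoinRoot.mk (shanksPoly (k : ZMod n))) ht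
  simpa using this

lemma shanksReduction_aeval (q : (ZMod n)[X]) (x : AdjoinRoot (shanksPoly (k : ZMod n))) :
    shanksReduction k h (aeval x q) =
      aeval (shanksReduction k h x) (q.map (ZMod.castHom h (ZMod m))) := by
  rw [aeval_def, hom_eval₂, aeval_def, eval₂_map]
  congr 1
  exact Subsingleton.elim _ _

end Reduction

lemma exists_algHom_shanksPoly_root_eq {A B : Type*} [CommRing A] [CommRing B] [Algebra A B]
    (k : A) {x : B} (hx : aeval x (shanksPoly k) = 0) :
    ∃ φ : AdjoinRoot (shanksPoly k) →ₐ[A] B, φ (AdjoinRoot.root _) = x :=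
  ⟨AdjoinRoot.liftAlgHom _ (Algebra.ofId A B) x hx, AdjoinRoot.liftAlgHom_root _ _ _ _⟩

lemma aeval_pow_shanksPoly_eq_zero {A : Type*} [CommRing A] (k : A) {n : ℕ}
    (hn : aeval (AdjoinRoot.root (shanksPoly k) ^ n) (shanksPoly k) = 0) (i : ℕ) :
    aeval (AdjoinRoot.root (shanksPoly k) ^ n ^ i) (shanksPoly k) = 0 := by
  induction i with
  | zero => simp
  | succ i ih =>
    obtain ⟨φ, hφ⟩ := exists_algHom_shanksPoly_root_eq k hn
    have h := congrArg φ ih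
    rw [map_zero, ← aeval_algHom_apply, map_pow, hφ, ← pow_mul, ← pow_succ'] at h
    exact h

lemma aeval_pow_card_shanksPoly {p : ℕ} [Fact p.Prime] (k : ZMod p) :
    aeval (AdjoinRoot.root (shanksPoly k) ^ p) (shanksPoly k) = 0 := by
  rw [← expand_aeval, ZMod.expand_card, map_pow, AdjoinRoot.aeval_eq, AdjoinRoot.mk_self,
    zero_pow (Fact.out : p.Prime).ne_zero]

lemma natCast_sq_eq_zero_adjoinRoot {p : ℕ} (f : (ZMod (p ^ 2))[X]) :
    (p : AdjoinRoot f) ^ 2 = 0 := by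
  have h : algebraMap (ZMod (p ^ 2)) (AdjoinRoot f) ((p ^ 2 : ℕ) : ZMod (p ^ 2)) = 0 := by
    rw [ZMod.natCast_self, map_zero]
  rwa [map_natCast, Nat.cast_pow] at h

lemma isNilpotent_of_shanksReduction_eq_zero {k : ℤ} {p : ℕ}
    {x : AdjoinRoot (shanksPoly (k : ZMod (p ^ 2)))}
    (hx : shanksReduction k (dvd_pow_self p two_ne_zero) x = 0) : IsNilpotent x := by
  obtain ⟨t, rfl⟩ := natCast_dvd_of_shanksReduction_eq_zero k _ hx
  exact ⟨2, by rw [mul_pow, natCast_sq_eq_zero_adjoinRoot, zero_mul]⟩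

section Irreducible

variable {p : ℕ} [Fact p.Prime]

lemma shanksPoly_root_pow_card_pow_three {k : ZMod p} (hirr : Irreducible (shanksPoly k)) :
    AdjoinRoot.root (shanksPoly k) ^ p ^ 3 = AdjoinRoot.root (shanksPoly k) := by
  have : Fact (Irreducible (shanksPoly k)) := ⟨hirr⟩
  have hfin : Module.finrank (ZMod p) (AdjoinRoot (shanksPoly k)) = 3 := by
    rw [(AdjoinRoot.powerBasis hirr.ne_zero).finrank, AdjoinRoot.powerBasis_dim,
      shanksPoly_natDegree]
  have : Module.Finite (ZMod p) (AdjoinRoot (shanksPoly k)) :=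
    (AdjoinRoot.powerBasis hirr.ne_zero).finite
  have : Finite (AdjoinRoot (shanksPoly k)) := Module.finite_of_finite (ZMod p)
  have hcard : Nat.card (AdjoinRoot (shanksPoly k)) = p ^ 3 := by
    rw [Module.natCard_eq_pow_finrank (K := ZMod p), hfin, Nat.card_zmod]
  have := Fintype.ofFinite (AdjoinRoot (shanksPoly k))
  rw [← hcard, Nat.card_eq_fintype_card, FiniteField.pow_card]

lemma shanksReduction_eq_zero_of_isNilpotent {k : ℤ}
    (hirr : Irreducible (shanksPoly (k : ZMod p)))
    {x : AdjoinRoot (shanksPoly (k : ZMod (p ^ 2)))} (hx : IsNilpotent x) :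
    shanksReduction k (dvd_pow_self p two_ne_zero) x = 0 := by
  have : Fact (Irreducible (shanksPoly (k : ZMod p))) := ⟨hirr⟩
  exact (hx.map _).eq_zero

lemma isUnit_of_shanksReduction_ne_zero {k : ℤ}
    (hirr : Irreducible (shanksPoly (k : ZMod p)))
    {x : AdjoinRoot (shanksPoly (k : ZMod (p ^ 2)))}
    (hx : shanksReduction k (dvd_pow_self p two_ne_zero) x ≠ 0) : IsUnit x := by
  have : Fact (Irreducible (shanksPoly (k : ZMod p))) := ⟨hirr⟩
  have hsurj : Function.Surjective (shanksReduction k (dvd_pow_self p two_ne_zero)) := by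
    intro y
    obtain ⟨g, rfl⟩ := AdjoinRoot.mk_surjective y
    obtain ⟨g', rfl⟩ := map_surjective _
      (ZMod.castHom_surjective (dvd_pow_self p two_ne_zero)) g
    exact ⟨AdjoinRoot.mk _ g', shanksReduction_mk _ _ _⟩
  obtain ⟨y, hy⟩ := hsurj (shanksReduction k (dvd_pow_self p two_ne_zero) x)⁻¹
  have h : IsNilpotent (x * y - 1) := by
    apply isNilpotent_of_shanksReduction_eq_zero
    rw [map_sub, map_mul, hy, mul_inv_cancel₀ hx, map_one, sub_self]
  have hu := h.isUnit_add_one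
  rw [sub_add_cancel] at hu
  exact isUnit_of_mul_isUnit_left hu

/-- Hensel's lemma: roots of `S_k` in the residue field lift uniquely modulo `p²`. -/
lemma existsUnique_shanksPoly_root_lift {k : ℤ}
    (hirr : Irreducible (shanksPoly (k : ZMod p)))
    (x : AdjoinRoot (shanksPoly (k : ZMod (p ^ 2))))
    (hx : aeval (shanksReduction k (dvd_pow_self p two_ne_zero) x)
      (shanksPoly (k : ZMod p)) = 0) :
    ∃! r, IsNilpotent (x - r) ∧ aeval r (shanksPoly (k : ZMod (p ^ 2))) = 0 := by
  have : Fact (Irreducible (shanksPoly (k : ZMod p))) := ⟨hirr⟩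
  have hder : aeval (shanksReduction k (dvd_pow_self p two_ne_zero) x)
      (derivative (shanksPoly (k : ZMod p))) ≠ 0 :=
    (PerfectField.separable_of_irreducible hirr).aeval_derivative_ne_zero hx
  have hmap : (shanksPoly (k : ZMod (p ^ 2))).map
      (ZMod.castHom (dvd_pow_self p two_ne_zero) (ZMod p)) = shanksPoly (k : ZMod p) := by
    rw [shanksPoly_map, map_intCast]
  apply existsUnique_nilpotent_sub_and_aeval_eq_zero
  · apply isNilpotent_of_shanksReduction_eq_zero
    rw [shanksReduction_aeval, hmap, hx]
  · apply isUnit_of_shanksReduction_ne_zero hirr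
    rwa [shanksReduction_aeval, ← derivative_map, hmap]

lemma orderOf_shanksPoly_root_coprime {k : ℤ}
    (hirr : Irreducible (shanksPoly (k : ZMod p))) :
    (orderOf (AdjoinRoot.root (shanksPoly (k : ZMod p)))).Coprime p := by
  have hp : p.Prime := Fact.out
  have h : orderOf (AdjoinRoot.root (shanksPoly (k : ZMod p))) ∣ p ^ 3 - 1 := by
    apply orderOf_dvd_of_pow_eq_one
    apply (shanksPoly_isUnit_root (k : ZMod p)).mul_left_cancel
    rw [mul_one, ← pow_succ', Nat.sub_add_cancel (Nat.one_le_pow _ _ hp.pos)]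
    exact shanksPoly_root_pow_card_pow_three hirr
  refine Nat.Coprime.coprime_dvd_left h ?_
  refine Nat.Coprime.coprime_dvd_right (dvd_pow_self p three_ne_zero) ?_
  exact (Nat.coprime_self_sub_left (Nat.one_le_pow _ _ hp.pos)).2 (Nat.coprime_one_left _)

lemma aeval_pow_eq_zero_of_orderOf_eq {k : ℤ}
    (hirr : Irreducible (shanksPoly (k : ZMod p)))
    (h : orderOf (AdjoinRoot.root (shanksPoly (k : ZMod (p ^ 2)))) =
      orderOf (AdjoinRoot.root (shanksPoly (k : ZMod p)))) :
    aeval (AdjoinRoot.root (shanksPoly (k : ZMod (p ^ 2))) ^ p)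
      (shanksPoly (k : ZMod (p ^ 2))) = 0 := by
  obtain ⟨r, ⟨hr, hroot⟩, -⟩ := existsUnique_shanksPoly_root_lift hirr
    (AdjoinRoot.root (shanksPoly (k : ZMod (p ^ 2))) ^ p)
    (by rw [map_pow, shanksReduction_root, aeval_pow_card_shanksPoly])
  have hpow := pow_orderOf_eq_one (AdjoinRoot.root (shanksPoly (k : ZMod (p ^ 2))))
  rw [h] at hpow
  have hcop := orderOf_shanksPoly_root_coprime hirr
  obtain ⟨φ, hφ⟩ := exists_algHom_shanksPoly_root_eq _ hroot
  have hrpow := congrArg φ hpow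
  rw [map_pow, hφ, map_one] at hrpow
  have hunit : IsUnit r := by
    rw [← hφ]
    exact (shanksPoly_isUnit_root _).map φ
  rw [eq_of_dvd_sub_of_pow_eq_one (natCast_sq_eq_zero_adjoinRoot _)
    hcop (natCast_dvd_of_shanksReduction_eq_zero k _
      (shanksReduction_eq_zero_of_isNilpotent hirr hr)) _ hrpow hunit]
  · exact hroot
  · rw [← pow_mul, mul_comm, pow_mul, hpow, one_pow]

lemma orderOf_eq_of_aeval_pow_eq_zero {k : ℤ}
    (hirr : Irreducible (shanksPoly (k : ZMod p)))
    (h : aeval (AdjoinRoot.root (shanksPoly (k : ZMod (p ^ 2))) ^ p)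
      (shanksPoly (k : ZMod (p ^ 2))) = 0) :
    orderOf (AdjoinRoot.root (shanksPoly (k : ZMod (p ^ 2)))) =
      orderOf (AdjoinRoot.root (shanksPoly (k : ZMod p))) := by
  have hp : p.Prime := Fact.out
  have hfix : AdjoinRoot.root (shanksPoly (k : ZMod (p ^ 2))) ^ p ^ 3 =
      AdjoinRoot.root (shanksPoly (k : ZMod (p ^ 2))) := by
    refine (existsUnique_shanksPoly_root_lift hirr
      (AdjoinRoot.root (shanksPoly (k : ZMod (p ^ 2)))) ?_).unique
      ⟨?_, aeval_pow_shanksPoly_eq_zero _ h 3⟩ ⟨by simp, by simp⟩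
    · rw [shanksReduction_root]; simp
    · apply isNilpotent_of_shanksReduction_eq_zero
      rw [map_sub, map_pow, shanksReduction_root, shanksPoly_root_pow_card_pow_three hirr,
        sub_self]
  have hone : AdjoinRoot.root (shanksPoly (k : ZMod (p ^ 2))) ^ (p ^ 3 - 1) = 1 := by
    apply (shanksPoly_isUnit_root (k : ZMod (p ^ 2))).mul_left_cancel
    rw [mul_one, ← pow_succ', Nat.sub_add_cancel (Nat.one_le_pow _ _ hp.pos), hfix]
  apply Nat.dvd_antisymm
  · apply orderOf_dvd_of_pow_eq_one
    refine eq_one_of_dvd_sub_one (natCast_sq_eq_zero_adjoinRoot _) (N := p ^ 3 - 1) ?_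
      (natCast_dvd_of_shanksReduction_eq_zero k (dvd_pow_self p two_ne_zero) ?_) ?_
    · refine Nat.Coprime.coprime_dvd_right (dvd_pow_self p three_ne_zero) ?_
      exact (Nat.coprime_self_sub_left (Nat.one_le_pow _ _ hp.pos)).2 (Nat.coprime_one_left _)
    · rw [map_sub, map_pow, shanksReduction_root, pow_orderOf_eq_one, map_one, sub_self]
    · rw [← pow_mul, mul_comm, pow_mul, hone, one_pow]
  · rw [← shanksReduction_root k (dvd_pow_self p two_ne_zero)]
    exact orderOf_map_dvd _ _

end Irreducible

/-- Let `k ≥ 1` and let `p` be a prime such that the Shanks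
polynomial `S_k(x) = x³ − k·x² − (k+3)·x − 1` is irreducible in `𝔽_p[x]`.
Then `p` is a `k`-Shanks prime if and only if the image of the polynomial
`S_k(x^p)` is zero in the ring `(ℤ/p²ℤ)[x]/(S_k(x))`. -/
theorem shanks_prime_iff (k : ℤ) (hk : 1 ≤ k) (p : ℕ) (hp : p.Prime)
    (hirr : Irreducible (X ^ 3 - C (k : ZMod p) * X ^ 2 - C ((k : ZMod p) + 3) * X - 1)) :
    IsShanksPrime k p ↔
      Ideal.Quotient.mk (Ideal.span ({X ^ 3 - C (k : ZMod (p ^ 2)) * X ^ 2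
          - C ((k : ZMod (p ^ 2)) + 3) * X - 1} : Set (ZMod (p ^ 2))[X]))
        (X ^ (3 * p) - C (k : ZMod (p ^ 2)) * X ^ (2 * p)
          - C ((k : ZMod (p ^ 2)) + 3) * X ^ p - 1) = 0 := by
  have : Fact p.Prime := ⟨hp⟩
  have hpoly : Ideal.Quotient.mk (Ideal.span ({X ^ 3 - C (k : ZMod (p ^ 2)) * X ^ 2
          - C ((k : ZMod (p ^ 2)) + 3) * X - 1} : Set (ZMod (p ^ 2))[X]))
        (X ^ (3 * p) - C (k : ZMod (p ^ 2)) * X ^ (2 * p)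
          - C ((k : ZMod (p ^ 2)) + 3) * X ^ p - 1) =
      aeval (AdjoinRoot.root (shanksPoly (k : ZMod (p ^ 2))) ^ p)
        (shanksPoly (k : ZMod (p ^ 2))) := by
    change AdjoinRoot.mk (shanksPoly (k : ZMod (p ^ 2))) _ = _
    rw [← expand_aeval, AdjoinRoot.aeval_eq]
    congr 1
    simp [shanksPoly, ← pow_mul, mul_comm p]
  rw [hpoly, IsShanksPrime, shanksPeriod_eq_orderOf, shanksPeriod_eq_orderOf]
  exact ⟨fun h => aeval_pow_eq_zero_of_orderOf_eq hirr h.2,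
    fun h => ⟨hp, orderOf_eq_of_aeval_pow_eq_zero hirr h⟩⟩
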